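/- Let I be a countable index set and, for each k ≥ 1, let X^k = (X^k_i)_{i∈I} be a family of random elements of a partially ordered Polish space X with closed partial order. Suppose each X^k is positively associated and X^k converges in distribution to X = (X_i)_{i∈I} (as random elements of the product space X^I) as k → ∞. Then X is positively associated. -/

import Mathlib

open MeasureTheory Filter

/-- A family `(Xs i)_{i ∈ ι}` of random elements of a partially ordered measurable space `X`
is *positively associated* if for every index set `J ⊆ ι` and all bounded measurable
coordinatewise nondecreasing `f, g : X^J → ℝ`, one has
`E[f(X_J) g(X_J)] ≥ E[f(X_J)] E[g(X_J)]`. -/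
def PosAssoc {Ω ι X : Type*} [MeasurableSpace Ω] [MeasurableSpace X] [Preorder X]
    (P : Measure Ω) (Xs : ι → Ω → X) : Prop :=
  ∀ (J : Set ι) (f g : (J → X) → ℝ),
    Measurable f → Monotone f → (∃ C, ∀ x, |f x| ≤ C) →
    Measurable g → Monotone g → (∃ C, ∀ x, |g x| ≤ C) →
    (∫ ω, f (fun j => Xs j.1 ω) ∂P) * ∫ ω, g (fun j => Xs j.1 ω) ∂P ≤
      ∫ ω, f (fun j => Xs j.1 ω) * g (fun j => Xs j.1 ω) ∂P

/-- In a space with closed order, the upper closure of a compact set is closed. -/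
theorem IsCompact.isClosed_upperClosure {Y : Type*} [TopologicalSpace Y] [Preorder Y]
    [OrderClosedTopology Y] {K : Set Y} (hK : IsCompact K) :
    IsClosed (upperClosure K : Set Y) := by
  rw [← isOpen_compl_iff, isOpen_iff_mem_nhds]
  intro y hy
  have key : ∀ᶠ z in nhds y, ∀ x ∈ K, ¬ x ≤ z := by
    refine hK.eventually_forall_of_forall_eventually fun x hx => ?_
    have hlt : {p : Y × Y | ¬ p.2 ≤ p.1} ∈ nhds (y, x) :=
      (isClosed_le_prod' (α := Y)).isOpen_compl.mem_nhds fun hxy => hy ⟨x, hx, hxy⟩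
    exact hlt
  filter_upwards [key] with z hz
  rintro ⟨x, hx, hxz⟩
  exact hz x hx hxz

/-- In a space with closed order, the lower closure of a compact set is closed. -/
theorem IsCompact.isClosed_lowerClosure {Y : Type*} [TopologicalSpace Y] [Preorder Y]
    [OrderClosedTopology Y] {K : Set Y} (hK : IsCompact K) :
    IsClosed (lowerClosure K : Set Y) :=
  IsCompact.isClosed_upperClosure (Y := Yᵒᵈ) hK

/-- Relative to a compact set `K`, every open neighbourhood of an upper set `C`
contains an open upper neighbourhood of `C`. -/
theorem IsUpperSet.exists_isOpen_inter_subset {Y : Type*} [TopologicalSpace Y] [Preorder Y]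
    [OrderClosedTopology Y] {C U K : Set Y} (hC : IsUpperSet C) (hU : IsOpen U) (hCU : C ⊆ U)
    (hK : IsCompact K) :
    ∃ V, IsOpen V ∧ IsUpperSet V ∧ C ⊆ V ∧ V ∩ K ⊆ U := by
  refine ⟨(lowerClosure (K \ U) : Set Y)ᶜ, (hK.diff hU).isClosed_lowerClosure.isOpen_compl,
    (lowerClosure (K \ U)).lower.compl, ?_, ?_⟩
  · rintro x hx ⟨y, hy, hxy⟩
    exact hy.2 (hCU (hC hxy hx))
  · rintro x ⟨hx, hxK⟩
    by_contra hxU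
    exact hx (subset_lowerClosure ⟨hxK, hxU⟩)

/-- The range of a convergent sequence of probability measures on a Polish space is tight. -/
theorem exists_isCompact_measure_compl_le_of_tendsto {Y : Type*} [TopologicalSpace Y]
    [PolishSpace Y] [MeasurableSpace Y] [BorelSpace Y] {μs : ℕ → ProbabilityMeasure Y}
    {μ : ProbabilityMeasure Y} (h : Tendsto μs atTop (nhds μ)) {ε : ENNReal} (hε : 0 < ε) :
    ∃ K : Set Y, IsCompact K ∧ ∀ k, (μs k : Measure Y) Kᶜ ≤ ε := by
  let _ := TopologicalSpace.upgradeIsCompletelyMetrizable Y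
  have hcomp : IsCompact (closure (Set.range μs)) :=
    h.isCompact_insert_range.closure_of_subset (Set.subset_insert _ _)
  obtain ⟨K, hK, hle⟩ := isTightMeasureSet_iff_exists_isCompact_measure_compl_le.1
    (isTightMeasureSet_of_isCompact_closure hcomp) ε hε
  exact ⟨K, hK, fun k => hle _ ⟨μs k, ⟨k, rfl⟩, rfl⟩⟩

/-- Positive correlation of open upper sets passes, in the weak limit, to closed upper sets. -/
theorem measure_mul_le_measure_inter_of_isClosed_of_tendsto {Y : Type*} [TopologicalSpace Y]
    [PolishSpace Y] [MeasurableSpace Y] [BorelSpace Y] [Preorder Y] [OrderClosedTopology Y]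
    {μs : ℕ → ProbabilityMeasure Y} {μ : ProbabilityMeasure Y} (h : Tendsto μs atTop (nhds μ))
    (hμs : ∀ k (V W : Set Y), IsOpen V → IsUpperSet V → IsOpen W → IsUpperSet W →
      (μs k : Measure Y) V * (μs k : Measure Y) W ≤ (μs k : Measure Y) (V ∩ W))
    {C D : Set Y} (hC : IsClosed C) (hCu : IsUpperSet C) (hD : IsClosed D) (hDu : IsUpperSet D) :
    (μ : Measure Y) C * (μ : Measure Y) D ≤ (μ : Measure Y) (C ∩ D) := by
  let _ := TopologicalSpace.upgradeIsCompletelyMetrizable Y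
  have thick : ∀ r : ℝ, 0 < r → (μ : Measure Y) C * (μ : Measure Y) D ≤
      (μ : Measure Y) (Metric.cthickening r C ∩ Metric.cthickening r D) := by
    intro r hr
    refine ENNReal.le_of_forall_pos_le_add fun ε hε _ => ?_
    obtain ⟨K, hK, hKε⟩ := exists_isCompact_measure_compl_le_of_tendsto h
      (ε := (ε : ENNReal)) (by exact_mod_cast hε)
    obtain ⟨V, hVo, hVu, hCV, hVK⟩ := hCu.exists_isOpen_inter_subset
      Metric.isOpen_thickening (Metric.self_subset_thickening hr C) hK
    obtain ⟨W, hWo, hWu, hDW, hWK⟩ := hDu.exists_isOpen_inter_subset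
      Metric.isOpen_thickening (Metric.self_subset_thickening hr D) hK
    have hbound : ∀ k, (μs k : Measure Y) V * (μs k : Measure Y) W ≤
        (μs k : Measure Y) (Metric.cthickening r C ∩ Metric.cthickening r D) + ε := by
      intro k
      refine (hμs k V W hVo hVu hWo hWu).trans ?_
      refine (measure_mono (t := (Metric.cthickening r C ∩ Metric.cthickening r D) ∪ Kᶜ) ?_).trans
        ((measure_union_le _ _).trans (by gcongr; exact hKε k))
      rintro x ⟨hxV, hxW⟩
      by_cases hx : x ∈ K
      · exact Or.inl ⟨Metric.thickening_subset_cthickening _ _ (hVK ⟨hxV, hx⟩),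
          Metric.thickening_subset_cthickening _ _ (hWK ⟨hxW, hx⟩)⟩
      · exact Or.inr hx
    refine ENNReal.mul_le_of_forall_lt fun a ha b hb => ?_
    have hVlim := ProbabilityMeasure.le_liminf_measure_open_of_tendsto h hVo
    have hWlim := ProbabilityMeasure.le_liminf_measure_open_of_tendsto h hWo
    have hTlim := ProbabilityMeasure.limsup_measure_closed_le_of_tendsto h
      ((Metric.isClosed_cthickening (δ := r) (E := C)).inter
        (Metric.isClosed_cthickening (δ := r) (E := D)))
    have hVa := eventually_lt_of_lt_liminf (ha.trans_le ((measure_mono hCV).trans hVlim))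
    have hWb := eventually_lt_of_lt_liminf (hb.trans_le ((measure_mono hDW).trans hWlim))
    rw [← tsub_le_iff_right]
    refine le_of_forall_gt fun c hc => ?_
    obtain ⟨c', hc', hc'c⟩ := exists_between hc
    have hTc := eventually_lt_of_limsup_lt (hTlim.trans_lt hc')
    obtain ⟨k, hkV, hkW, hkT⟩ := (hVa.and (hWb.and hTc)).exists
    refine lt_of_le_of_lt ?_ hc'c
    rw [tsub_le_iff_right]
    calc a * b ≤ _ := mul_le_mul' hkV.le hkW.le
      _ ≤ _ := hbound k
      _ ≤ c' + ε := by gcongr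
  have hlim : Tendsto
      (fun n : ℕ => (μ : Measure Y) (Metric.cthickening (1 / ((n : ℝ) + 1)) C ∩
        Metric.cthickening (1 / ((n : ℝ) + 1)) D)) atTop (nhds ((μ : Measure Y) (C ∩ D))) := by
    have hCD : C ∩ D = ⋂ n : ℕ, Metric.cthickening (1 / ((n : ℝ) + 1)) C ∩
        Metric.cthickening (1 / ((n : ℝ) + 1)) D := by
      have aux : ∀ E : Set Y, IsClosed E →
          ⋂ n : ℕ, Metric.cthickening (1 / ((n : ℝ) + 1)) E = E := by
        intro E hE
        refine Set.Subset.antisymm (fun x hx => ?_)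
          (Set.subset_iInter fun n => Metric.self_subset_cthickening E)
        rw [← hE.closure_eq, Metric.closure_eq_iInter_cthickening]
        simp only [Set.mem_iInter] at hx ⊢
        intro δ hδ
        obtain ⟨n, hn⟩ := exists_nat_one_div_lt hδ
        exact Metric.cthickening_mono hn.le E (hx n)
      rw [Set.iInter_inter_distrib, aux C hC, aux D hD]
    rw [hCD]
    refine tendsto_measure_iInter_atTop
      (fun n => (Metric.isClosed_cthickening.inter
        Metric.isClosed_cthickening).measurableSet.nullMeasurableSet) ?_
      ⟨0, measure_ne_top _ _⟩
    intro m n hmn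
    have := Nat.one_div_le_one_div (α := ℝ) hmn
    exact Set.inter_subset_inter (Metric.cthickening_mono this C) (Metric.cthickening_mono this D)
  exact ge_of_tendsto' hlim fun n => thick _ Nat.one_div_pos_of_nat

/-- Positive correlation of closed upper sets implies that of all Borel upper sets. -/
theorem measure_mul_le_measure_inter_of_forall_isClosed {Y : Type*} [TopologicalSpace Y]
    [PolishSpace Y] [MeasurableSpace Y] [BorelSpace Y] [Preorder Y] [OrderClosedTopology Y]
    {μ : Measure Y} [IsFiniteMeasure μ]
    (hμ : ∀ C D : Set Y, IsClosed C → IsUpperSet C → IsClosed D → IsUpperSet D →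
      μ C * μ D ≤ μ (C ∩ D))
    {A B : Set Y} (hA : MeasurableSet A) (hAu : IsUpperSet A)
    (hB : MeasurableSet B) (hBu : IsUpperSet B) :
    μ A * μ B ≤ μ (A ∩ B) := by
  refine ENNReal.mul_le_of_forall_lt fun a ha b hb => ?_
  obtain ⟨K, hKA, hK, haK⟩ := hA.exists_lt_isCompact_of_ne_top (measure_ne_top μ A) ha
  obtain ⟨L, hLB, hL, hbL⟩ := hB.exists_lt_isCompact_of_ne_top (measure_ne_top μ B) hb
  calc a * b ≤ μ (upperClosure K) * μ (upperClosure L) :=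
        mul_le_mul' (haK.le.trans (measure_mono subset_upperClosure))
          (hbL.le.trans (measure_mono subset_upperClosure))
    _ ≤ μ (upperClosure K ∩ upperClosure L) :=
        hμ _ _ hK.isClosed_upperClosure (upperClosure K).upper
          hL.isClosed_upperClosure (upperClosure L).upper
    _ ≤ μ (A ∩ B) := measure_mono
        (Set.inter_subset_inter (upperClosure_min hKA hAu) (upperClosure_min hLB hBu))

/-- Positive correlation of measurable upper sets implies that of nonnegative measurable
monotone functions. -/
theorem lintegral_mul_le_lintegral_mul_of_monotone {Y : Type*} [MeasurableSpace Y] [Preorder Y]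
    {μ : Measure Y}
    (hμ : ∀ A B : Set Y, MeasurableSet A → IsUpperSet A → MeasurableSet B → IsUpperSet B →
      μ A * μ B ≤ μ (A ∩ B))
    {f g : Y → ℝ} (hf : Measurable f) (hfm : Monotone f) (hf0 : 0 ≤ f)
    (hg : Measurable g) (hgm : Monotone g) (hg0 : 0 ≤ g) :
    (∫⁻ y, ENNReal.ofReal (f y) ∂μ) * ∫⁻ y, ENNReal.ofReal (g y) ∂μ ≤
      ∫⁻ y, ENNReal.ofReal (f y) * ENNReal.ofReal (g y) ∂μ := by
  have level : ∀ {h : Y → ℝ}, Measurable h → Monotone h → ∀ t,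
      MeasurableSet {y | t < h y} ∧ IsUpperSet {y | t < h y} := fun hh hm t =>
    ⟨measurableSet_lt measurable_const hh, fun _ _ hxy hx => lt_of_lt_of_le hx (hm hxy)⟩
  have layer : ∀ {h : Y → ℝ} (ν : Measure Y), Measurable h → 0 ≤ h →
      ∫⁻ y, ENNReal.ofReal (h y) ∂ν = ∫⁻ t in Set.Ioi 0, ν {y | t < h y} := fun ν hh h0 =>
    lintegral_eq_lintegral_meas_lt ν (Eventually.of_forall h0) hh.aemeasurable
  have meas : ∀ {h : Y → ℝ} (ν : Measure Y), Measurable fun t : ℝ => ν {y | t < h y} :=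
    fun ν => Antitone.measurable fun s t hst => measure_mono fun y hy => lt_of_le_of_lt hst hy
  have step : ∀ B : Set Y, MeasurableSet B → IsUpperSet B →
      (∫⁻ y, ENNReal.ofReal (f y) ∂μ) * μ B ≤ ∫⁻ y in B, ENNReal.ofReal (f y) ∂μ := by
    intro B hB hBu
    rw [layer μ hf hf0, layer _ hf hf0, ← lintegral_mul_const _ (meas μ)]
    refine lintegral_mono fun t => ?_
    obtain ⟨hm, hu⟩ := level hf hfm t
    rw [Measure.restrict_apply hm]
    exact hμ _ _ hm hu hB hBu
  have hfe : Measurable fun y => ENNReal.ofReal (f y) := hf.ennreal_ofReal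
  calc (∫⁻ y, ENNReal.ofReal (f y) ∂μ) * ∫⁻ y, ENNReal.ofReal (g y) ∂μ
      = ∫⁻ t in Set.Ioi 0, (∫⁻ y, ENNReal.ofReal (f y) ∂μ) * μ {y | t < g y} := by
        rw [layer μ hg hg0, lintegral_const_mul _ (meas μ)]
    _ ≤ ∫⁻ t in Set.Ioi 0, (μ.withDensity fun y => ENNReal.ofReal (f y)) {y | t < g y} := by
        refine lintegral_mono fun t => ?_
        obtain ⟨hm, hu⟩ := level hg hgm t
        rw [withDensity_apply _ hm]
        exact step _ hm hu
    _ = ∫⁻ y, ENNReal.ofReal (g y) ∂(μ.withDensity fun y => ENNReal.ofReal (f y)) :=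
        (layer _ hg hg0).symm
    _ = ∫⁻ y, ENNReal.ofReal (f y) * ENNReal.ofReal (g y) ∂μ :=
        lintegral_withDensity_eq_lintegral_mul _ hfe hg.ennreal_ofReal

/-- Positive correlation of measurable upper sets implies that of bounded measurable
monotone functions. -/
theorem integral_mul_le_integral_mul_of_monotone {Y : Type*} [MeasurableSpace Y] [Preorder Y]
    {μ : Measure Y} [IsProbabilityMeasure μ]
    (hμ : ∀ A B : Set Y, MeasurableSet A → IsUpperSet A → MeasurableSet B → IsUpperSet B →
      μ A * μ B ≤ μ (A ∩ B))
    {f g : Y → ℝ} (hf : Measurable f) (hfm : Monotone f) (hfb : ∃ C, ∀ y, |f y| ≤ C)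
    (hg : Measurable g) (hgm : Monotone g) (hgb : ∃ C, ∀ y, |g y| ≤ C) :
    (∫ y, f y ∂μ) * ∫ y, g y ∂μ ≤ ∫ y, f y * g y ∂μ := by
  obtain ⟨a, ha⟩ := hfb
  obtain ⟨b, hb⟩ := hgb
  have hfi : Integrable f μ := .of_bound hf.aestronglyMeasurable a (Eventually.of_forall ha)
  have hgi : Integrable g μ := .of_bound hg.aestronglyMeasurable b (Eventually.of_forall hb)
  have hfgi : Integrable (fun y => f y * g y) μ :=
    hgi.bdd_mul hf.aestronglyMeasurable (Eventually.of_forall ha)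
  have hf0 : ∀ y, 0 ≤ f y + a := fun y => by linarith [neg_le_of_abs_le (ha y)]
  have hg0 : ∀ y, 0 ≤ g y + b := fun y => by linarith [neg_le_of_abs_le (hb y)]
  have hfai : Integrable (fun y => f y + a) μ := hfi.add (integrable_const a)
  have hgbi : Integrable (fun y => g y + b) μ := hgi.add (integrable_const b)
  have hexp : (fun y => (f y + a) * (g y + b)) =
      fun y => f y * g y + b * f y + a * g y + a * b := by
    funext y; ring
  have hi1 : Integrable (fun y => f y * g y + b * f y) μ := hfgi.add (hfi.const_mul b)
  have hi2 : Integrable (fun y => f y * g y + b * f y + a * g y) μ := hi1.add (hgi.const_mul a)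
  have hprodi : Integrable (fun y => (f y + a) * (g y + b)) μ := by
    rw [hexp]
    exact hi2.add (integrable_const _)
  have key : (∫ y, (f y + a) ∂μ) * ∫ y, (g y + b) ∂μ ≤ ∫ y, (f y + a) * (g y + b) ∂μ := by
    have := lintegral_mul_le_lintegral_mul_of_monotone hμ (hf.add_const a)
      (fun x y h => add_le_add_left (hfm h) a) hf0 (hg.add_const b)
      (fun x y h => add_le_add_left (hgm h) b) hg0
    simp_rw [← ENNReal.ofReal_mul (hf0 _)] at this
    rw [← ofReal_integral_eq_lintegral_ofReal hfai (Eventually.of_forall hf0),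
      ← ofReal_integral_eq_lintegral_ofReal hgbi (Eventually.of_forall hg0),
      ← ofReal_integral_eq_lintegral_ofReal hprodi
        (Eventually.of_forall fun y => mul_nonneg (hf0 y) (hg0 y)),
      ← ENNReal.ofReal_mul (integral_nonneg hf0)] at this
    exact (ENNReal.ofReal_le_ofReal_iff
      (integral_nonneg fun y => mul_nonneg (hf0 y) (hg0 y))).1 this
  rw [hexp, integral_add hi2 (integrable_const _), integral_add hi1 (hgi.const_mul a),
    integral_add hfgi (hfi.const_mul b), integral_add hfi (integrable_const a),
    integral_add hgi (integrable_const b), integral_const_mul, integral_const_mul] at key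
  simp only [integral_const, probReal_univ, one_smul] at key
  linarith

/-- The joint law of a positively associated family gives positively correlated mass to
measurable upper sets. -/
theorem PosAssoc.measure_mul_le_measure_inter {ι X : Type*} [MeasurableSpace X] [Preorder X]
    {μ : Measure (ι → X)} [IsFiniteMeasure μ] (h : PosAssoc μ fun i x => x i)
    {A B : Set (ι → X)} (hA : MeasurableSet A) (hAu : IsUpperSet A)
    (hB : MeasurableSet B) (hBu : IsUpperSet B) :
    μ A * μ B ≤ μ (A ∩ B) := by
  have hext : Measurable fun (x : ↥(Set.univ : Set ι) → X) (i : ι) => x ⟨i, Set.mem_univ i⟩ :=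
    measurable_pi_lambda _ fun i => measurable_pi_apply _
  have hind : ∀ {S : Set (ι → X)}, IsUpperSet S →
      Monotone (S.indicator fun _ => (1 : ℝ)) := by
    intro S hS x y hxy
    by_cases hx : x ∈ S
    · simp [hx, hS hxy hx]
    · rw [Set.indicator_of_notMem hx]
      exact Set.indicator_nonneg (fun _ _ => zero_le_one) y
  have hbd : ∀ (S : Set (ι → X)) (x : ι → X), |S.indicator (fun _ => (1 : ℝ)) x| ≤ 1 := by
    intro S x
    by_cases hx : x ∈ S <;> simp [hx]
  have := h Set.univ
    (fun x => A.indicator (fun _ => (1 : ℝ)) fun i => x ⟨i, Set.mem_univ i⟩)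
    (fun x => B.indicator (fun _ => (1 : ℝ)) fun i => x ⟨i, Set.mem_univ i⟩)
    ((measurable_const.indicator hA).comp hext) (fun x y hxy => hind hAu fun i => hxy _)
    ⟨1, fun x => hbd A _⟩
    ((measurable_const.indicator hB).comp hext) (fun x y hxy => hind hBu fun i => hxy _)
    ⟨1, fun x => hbd B _⟩
  have hmul : (fun x : ι → X => A.indicator (fun _ => (1 : ℝ)) x *
      B.indicator (fun _ => (1 : ℝ)) x) = (A ∩ B).indicator fun _ => (1 : ℝ) := by
    funext x
    by_cases hx : x ∈ A <;> by_cases hx' : x ∈ B <;> simp [hx, hx']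
  change (∫ x, A.indicator (fun _ => (1 : ℝ)) x ∂μ) * ∫ x, B.indicator (fun _ => (1 : ℝ)) x ∂μ ≤
    ∫ x, A.indicator (fun _ => (1 : ℝ)) x * B.indicator (fun _ => (1 : ℝ)) x ∂μ at this
  rw [hmul, integral_indicator_const _ hA, integral_indicator_const _ hB,
    integral_indicator_const _ (hA.inter hB)] at this
  simp only [smul_eq_mul, mul_one] at this
  rwa [measureReal_def, measureReal_def, measureReal_def, ← ENNReal.toReal_mul,
    ENNReal.toReal_le_toReal (ENNReal.mul_ne_top (measure_ne_top _ _) (measure_ne_top _ _))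
      (measure_ne_top _ _)] at this

/-- Positive association of countable families of random elements of a partially ordered
Polish space with closed partial order is preserved under convergence in distribution.
Here the families are identified with their joint laws `μs k` on the product space
`ι → X`, with coordinate projections as the random elements, and convergence in
distribution is weak convergence: the integrals of every bounded continuous function on
the product space converge. -/
theorem posAssoc_of_tendsto_posAssoc
    {ι X : Type*} [Countable ι]
    [TopologicalSpace X] [PolishSpace X] [MeasurableSpace X] [BorelSpace X]
    [PartialOrder X] [OrderClosedTopology X]
    (μs : ℕ → Measure (ι → X)) (μ : Measure (ι → X))
    [∀ k, IsProbabilityMeasure (μs k)] [IsProbabilityMeasure μ]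
    (hPA : ∀ k, PosAssoc (μs k) (fun i x => x i))
    (hconv : ∀ F : BoundedContinuousFunction (ι → X) ℝ,
      Tendsto (fun k => ∫ x, F x ∂(μs k)) atTop (nhds (∫ x, F x ∂μ))) :
    PosAssoc μ (fun i x => x i) := by
  let νs : ℕ → ProbabilityMeasure (ι → X) := fun k => ⟨μs k, inferInstance⟩
  let ν : ProbabilityMeasure (ι → X) := ⟨μ, inferInstance⟩
  have hν : Tendsto νs atTop (nhds ν) :=
    ProbabilityMeasure.tendsto_iff_forall_integral_tendsto.2 hconv
  have hclosed : ∀ C D : Set (ι → X), IsClosed C → IsUpperSet C → IsClosed D → IsUpperSet D →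
      μ C * μ D ≤ μ (C ∩ D) := fun C D hC hCu hD hDu =>
    measure_mul_le_measure_inter_of_isClosed_of_tendsto hν
      (fun k V W hV hVu hW hWu =>
        (hPA k).measure_mul_le_measure_inter hV.measurableSet hVu hW.measurableSet hWu)
      hC hCu hD hDu
  intro J f g hf hfm hfb hg hgm hgb
  have hres : Measurable fun (x : ι → X) (j : J) => x j.1 :=
    measurable_pi_lambda _ fun j => measurable_pi_apply _
  exact integral_mul_le_integral_mul_of_monotone
    (fun A B hA hAu hB hBu =>
      measure_mul_le_measure_inter_of_forall_isClosed hclosed hA hAu hB hBu)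
    (hf.comp hres) (fun x y hxy => hfm fun j => hxy _) (hfb.imp fun _ h x => h _)
    (hg.comp hres) (fun x y hxy => hgm fun j => hxy _) (hgb.imp fun _ h x => h _)
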